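/- In the exterior Dirichlet setting, there is a constant c independent of R such that for every R > 4R₀ and every solution u = u^R, max over B_R∖int K of |D²u| ≤ c + max over ∂B_R ∪ ∂K of |D²u|, where |D²u| denotes the operator norm (equivalently, largest eigenvalue) of the Hessian of u. -/

import Mathlib

open Metric Set Filter
open scoped Topology RealInnerProductSpace

noncomputable section

abbrev Euc (n : ℕ) : Type := EuclideanSpace ℝ (Fin n)

/-- The Hessian matrix of `u` at `x`, `(u_{ij})`. -/
noncomputable def Hess {n : ℕ} (u : Euc n → ℝ) (x : Euc n) : Matrix (Fin n) (Fin n) ℝ :=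
  fun i j => iteratedFDeriv ℝ 2 u x ![EuclideanSpace.single i 1, EuclideanSpace.single j 1]

/-- The Gauß curvature operator `K[u] = det D²u / (1+|Du|²)^((n+2)/2)`. -/
noncomputable def gaussK {n : ℕ} (u : Euc n → ℝ) (x : Euc n) : ℝ :=
  (Hess u x).det / (1 + ‖fderiv ℝ u x‖ ^ 2) ^ (((n : ℝ) + 2) / 2)

/-- Partial derivative `w_i` relative to a set `S`. -/
noncomputable def pdW {n : ℕ} (S : Set (Euc n)) (w : Euc n → ℝ) (x : Euc n) (i : Fin n) : ℝ :=
  fderivWithin ℝ w S x (EuclideanSpace.single i 1)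

/-- The Hessian matrix `(w_{ij})` relative to a set `S`. -/
noncomputable def HessW {n : ℕ} (S : Set (Euc n)) (w : Euc n → ℝ) (x : Euc n) :
    Matrix (Fin n) (Fin n) ℝ :=
  fun i j => iteratedFDerivWithin ℝ 2 w S x
    ![EuclideanSpace.single i 1, EuclideanSpace.single j 1]

/-- The exterior Dirichlet setting of Finster–Schnürer. -/
structure ExtSetting (n : ℕ) where
  K : Set (Euc n)
  f : Euc n → ℝ → ℝ
  u₀ : Euc n → ℝ
  ul : Euc n → ℝ
  R₀ : ℝ
  hn : 2 ≤ n
  hR₀ : 0 < R₀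
  hKne : K.Nonempty
  hKc : IsCompact K
  hK0 : 0 ∈ interior K
  hKsm : ∃ g : Euc n → ℝ, ContDiff ℝ (⊤ : ℕ∞) g ∧ K = {x | g x ≤ 0} ∧
    ∀ x ∈ frontier K, fderiv ℝ g x ≠ 0
  hKR₀ : K ⊆ ball 0 R₀
  hfsm : ContDiffOn ℝ (⊤ : ℕ∞) (fun p : Euc n × ℝ => f p.1 p.2) ((interior K)ᶜ ×ˢ univ)
  hfpos : ∀ x ∈ (interior K)ᶜ, ∀ z : ℝ, 0 < f x z
  hfz : ∀ x ∈ (interior K)ᶜ, Monotone (f x)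
  hfdec : ∃ C : ℝ, ∀ x ∈ (interior K)ᶜ, ∀ z : ℝ, f x z * ‖x‖ ^ (n + 1) ≤ C
  hfder : ∃ C : ℝ, ∀ p ∈ (interior K)ᶜ ×ˢ (univ : Set ℝ),
    ‖fderivWithin ℝ (fun q : Euc n × ℝ => f q.1 q.2) ((interior K)ᶜ ×ˢ univ) p‖ +
      ‖iteratedFDerivWithin ℝ 2 (fun q : Euc n × ℝ => f q.1 q.2) ((interior K)ᶜ ×ˢ univ) p‖
        ≤ C * f p.1 p.2
  hulsm : ContDiffOn ℝ (⊤ : ℕ∞) ul (interior K)ᶜ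
  hulconv : ∀ x ∈ Kᶜ, (Hess ul x).PosDef
  hulsub : ∀ x ∈ Kᶜ, f x (ul x) ≤ gaussK ul x
  hulbc : ∀ x ∈ frontier K, ul x = u₀ x
  hulcone : ∃ C : ℝ, ∀ x ∈ (interior K)ᶜ, |ul x - ‖x‖| ≤ C
  huldec1 : ∃ C R₁ : ℝ, ∀ x : Euc n, R₁ ≤ ‖x‖ →
    ‖fderiv ℝ (fun y => ul y - ‖y‖) x‖ ≤ C / ‖x‖
  huldec2 : ∃ C R₁ : ℝ, ∀ x : Euc n, R₁ ≤ ‖x‖ →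
    ‖iteratedFDeriv ℝ 2 (fun y => ul y - ‖y‖) x‖ + ‖iteratedFDeriv ℝ 3 ul x‖ ≤ C / ‖x‖ ^ 2

/-- The domain `B_R ∖ int K` of the compact Dirichlet problem. -/
def solDom {n : ℕ} (S : ExtSetting n) (R : ℝ) : Set (Euc n) :=
  closedBall 0 R \ interior S.K

/-- `u` is a smooth strictly convex solution `u^R` of the compact Dirichlet problem
`K[u^R] = f(x,u^R)` in `B_R ∖ K`, `u^R = u̲` on `∂B_R ∪ ∂K`. -/
def IsSol {n : ℕ} (S : ExtSetting n) (R : ℝ) (u : Euc n → ℝ) : Prop :=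
  ContDiffOn ℝ (⊤ : ℕ∞) u (solDom S R) ∧
  (∀ x ∈ ball 0 R \ S.K, (Hess u x).PosDef) ∧
  (∀ x ∈ ball 0 R \ S.K, gaussK u x = S.f x (u x)) ∧
  (∀ x ∈ sphere (0 : Euc n) R ∪ frontier S.K, u x = S.ul x)

open Matrix in
theorem posSemidef_det_le {n : ℕ} (hn : 0 < n) {B : Matrix (Fin n) (Fin n) ℝ}
    (hB : B.PosSemidef) : B.det ≤ (B.trace / n) ^ n := by
  have hn' : (0 : ℝ) < n := by exact_mod_cast hn
  rw [hB.1.det_eq_prod_eigenvalues, hB.1.trace_eq_sum_eigenvalues]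
  have h := Real.geom_mean_le_arith_mean Finset.univ (fun _ : Fin n => (1 : ℝ)) hB.1.eigenvalues
    (by simp) (by simpa using hn) (fun i _ => hB.eigenvalues_nonneg i)
  simp only [Real.rpow_one, Finset.sum_const, Finset.card_univ, Fintype.card_fin, nsmul_eq_mul,
    mul_one, one_mul] at h
  have hp : 0 ≤ ∏ i, hB.1.eigenvalues i :=
    Finset.prod_nonneg fun i _ => hB.eigenvalues_nonneg i
  have := pow_le_pow_left₀ (Real.rpow_nonneg hp _) h n
  rwa [Real.rpow_inv_natCast_pow hp hn.ne'] at this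

open Matrix MatrixOrder in
/-- A frame orthonormal for a positive definite matrix `A`, together with the arithmetic-geometric
mean inequality it yields for determinants. -/
theorem exists_orthonormal_frame {n : ℕ} (hn : 0 < n) {A : Matrix (Fin n) (Fin n) ℝ}
    (hA : A.PosDef) :
    ∃ (η : Fin n → Fin n → ℝ) (d : ℝ), 0 < d ∧ A.det * d = 1 ∧
      ∑ k, η k ⬝ᵥ A *ᵥ η k = n ∧
      (∀ B : Matrix (Fin n) (Fin n) ℝ, B.PosSemidef →
        B.det * d ≤ ((∑ k, η k ⬝ᵥ B *ᵥ η k) / n) ^ n) ∧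
      ∀ e : Fin n → ℝ, (e ⬝ᵥ e) ^ 2 ≤ (e ⬝ᵥ A *ᵥ e) * ∑ k, (e ⬝ᵥ η k) ^ 2 := by
  obtain ⟨C, hC⟩ := CStarAlgebra.nonneg_iff_eq_star_mul_self.mp
    (Matrix.nonneg_iff_posSemidef.mpr hA.posSemidef)
  rw [star_eq_conjTranspose, conjTranspose_eq_transpose_of_trivial] at hC
  have hdet : A.det = C.det ^ 2 := by rw [hC, det_mul, det_transpose, sq]
  have hCdet : C.det ≠ 0 := by
    intro h
    have := hA.det_pos
    rw [hdet, h] at this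
    simp at this
  have hCu : IsUnit C.det := isUnit_iff_ne_zero.mpr hCdet
  have htr : ∀ B : Matrix (Fin n) (Fin n) ℝ,
      ∑ k, (fun i => C⁻¹ i k) ⬝ᵥ B *ᵥ (fun i => C⁻¹ i k) = (C⁻¹ᵀ * B * C⁻¹).trace := by
    intro B
    simp only [Matrix.trace, diag_apply, Matrix.mul_assoc]
    refine Finset.sum_congr rfl fun k _ => ?_
    simp [Matrix.mul_apply, dotProduct, mulVec]
  refine ⟨fun k i => C⁻¹ i k, (C⁻¹).det ^ 2, ?_, ?_, ?_, ?_, ?_⟩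
  · have : (C⁻¹).det ≠ 0 := by
      rw [det_nonsing_inv, Ring.inverse_eq_inv']
      exact inv_ne_zero hCdet
    positivity
  · rw [hdet, ← mul_pow, ← det_mul, mul_nonsing_inv _ hCu]; simp
  · rw [htr, hC]
    have : C⁻¹ᵀ * (Cᵀ * C) * C⁻¹ = 1 := by
      rw [← Matrix.mul_assoc, ← transpose_mul, mul_nonsing_inv _ hCu, transpose_one, Matrix.one_mul,
        mul_nonsing_inv _ hCu]
    rw [this]; simp
  · intro B hB
    rw [htr]
    have h1 : (C⁻¹ᵀ * B * C⁻¹).PosSemidef := by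
      have := hB.conjTranspose_mul_mul_same C⁻¹
      rwa [conjTranspose_eq_transpose_of_trivial] at this
    have h2 := posSemidef_det_le hn h1
    rw [det_mul, det_mul, det_transpose] at h2
    calc _ = C⁻¹.det * B.det * C⁻¹.det := by ring
      _ ≤ _ := h2
  · intro e
    have h1 : e ⬝ᵥ A *ᵥ e = ∑ k, (C *ᵥ e) k ^ 2 := by
      rw [hC, ← mulVec_mulVec, dotProduct_mulVec, vecMul_transpose]
      simp [dotProduct, sq]
    have h2 : ∀ k, (e ⬝ᵥ fun i => C⁻¹ i k) = (e ᵥ* C⁻¹) k := fun k => rfl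
    have h3 : e ⬝ᵥ e = ∑ k, (C *ᵥ e) k * (e ᵥ* C⁻¹) k := by
      have : e ᵥ* C⁻¹ ⬝ᵥ C *ᵥ e = e ⬝ᵥ e := by
        rw [← dotProduct_mulVec, mulVec_mulVec, nonsing_inv_mul _ hCu, one_mulVec]
      rw [← this, dotProduct_comm]; rfl
    rw [h1, h3]
    simp only [h2]
    exact Finset.sum_mul_sq_le_sq_mul_sq _ _ _

/-- The second order necessary condition at a local maximum. -/
theorem IsLocalMax.second_deriv_nonpos {g g' : ℝ → ℝ} {g'' : ℝ} (hmax : IsLocalMax g 0)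
    (hg : ∀ᶠ t in 𝓝 0, HasDerivAt g (g' t) t) (hg' : HasDerivAt g' g'' 0) : g'' ≤ 0 := by
  by_contra! h
  have h1 : deriv g =ᶠ[𝓝 0] g' := hg.mono fun t ht => ht.deriv
  have h2 : deriv (deriv g) 0 = g'' := h1.deriv_eq.trans hg'.deriv
  have hmin := isLocalMin_of_deriv_deriv_pos (by rw [h2]; exact h) hmax.deriv_eq_zero
    hg.self_of_nhds.continuousAt
  have hc : g =ᶠ[𝓝 0] fun _ => g 0 := by
    filter_upwards [hmax, hmin] with t h1 h2 using le_antisymm h1 h2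
  have h3 : deriv g =ᶠ[𝓝 0] fun _ => (0 : ℝ) := by
    simpa using hc.deriv
  have := h3.deriv_eq
  rw [h2] at this
  simp at this
  exact h.ne' this

/-- The directional derivative of `u` in direction `v`, as a function of the base point. -/
noncomputable def dirD {n : ℕ} (v : Euc n) (u : Euc n → ℝ) (y : Euc n) : ℝ := fderiv ℝ u y v

theorem two_le_smooth : (2 : WithTop ℕ∞) ≤ ((⊤ : ℕ∞) : WithTop ℕ∞) :=
  WithTop.coe_le_coe.mpr (le_top : (2 : ℕ∞) ≤ ⊤)

section DirectionalDerivative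

variable {n : ℕ} {U : Set (Euc n)} {u : Euc n → ℝ}

theorem ContDiffOn.dirD (hu : ContDiffOn ℝ (⊤ : ℕ∞) u U) (hU : IsOpen U) (v : Euc n) :
    ContDiffOn ℝ (⊤ : ℕ∞) (dirD v u) U :=
  (hu.fderiv_of_isOpen hU (by simp)).clm_apply contDiffOn_const

theorem ContDiffOn.differentiableAt_of_isOpen (hu : ContDiffOn ℝ (⊤ : ℕ∞) u U) (hU : IsOpen U)
    {x : Euc n} (hx : x ∈ U) : DifferentiableAt ℝ u x :=
  (hu.contDiffAt (hU.mem_nhds hx)).differentiableAt (by simp)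

theorem ContDiffOn.differentiableAt_fderiv (hu : ContDiffOn ℝ (⊤ : ℕ∞) u U) (hU : IsOpen U)
    {x : Euc n} (hx : x ∈ U) : DifferentiableAt ℝ (fderiv ℝ u) x :=
  ((hu.fderiv_of_isOpen (m := (⊤ : ℕ∞)) hU (by simp)).contDiffAt
    (hU.mem_nhds hx)).differentiableAt (by simp)

theorem dirD_dirD (hu : ContDiffOn ℝ (⊤ : ℕ∞) u U) (hU : IsOpen U) (v w : Euc n) {x : Euc n}
    (hx : x ∈ U) : dirD v (dirD w u) x = fderiv ℝ (fderiv ℝ u) x v w := by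
  have h := (hu.differentiableAt_fderiv hU hx).hasFDerivAt.clm_apply (hasFDerivAt_const w x)
  have h2 : fderiv ℝ (dirD w u) x = _ := h.fderiv
  rw [dirD, h2]
  simp

theorem dirD_comm (hu : ContDiffOn ℝ (⊤ : ℕ∞) u U) (hU : IsOpen U) (v w : Euc n) {x : Euc n}
    (hx : x ∈ U) : dirD v (dirD w u) x = dirD w (dirD v u) x := by
  rw [dirD_dirD hu hU v w hx, dirD_dirD hu hU w v hx]
  exact ((hu.contDiffAt (hU.mem_nhds hx)).isSymmSndFDerivAt
    (by rw [minSmoothness_of_isRCLikeNormedField]; exact two_le_smooth)).eq v w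

theorem dirD_congr {u' : Euc n → ℝ} (h : EqOn u u' U) (hU : IsOpen U) (v : Euc n) :
    EqOn (dirD v u) (dirD v u') U := fun x hx => by
  rw [dirD, dirD, (h.eventuallyEq_of_mem (hU.mem_nhds hx)).fderiv_eq]

theorem hasDerivAt_line (hu : ContDiffOn ℝ (⊤ : ℕ∞) u U) (hU : IsOpen U) (x v : Euc n) {t : ℝ}
    (hx : x + t • v ∈ U) :
    HasDerivAt (fun s : ℝ => u (x + s • v)) (dirD v u (x + t • v)) t := by
  have h1 : HasDerivAt (fun s : ℝ => x + s • v) v t := by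
    simpa using ((hasDerivAt_id t).smul_const v).const_add x
  exact (hu.differentiableAt_of_isOpen hU hx).hasFDerivAt.comp_hasDerivAt t h1

theorem eventually_line_mem (hU : IsOpen U) {x : Euc n} (hx : x ∈ U) (v : Euc n) :
    ∀ᶠ t : ℝ in 𝓝 0, x + t • v ∈ U := by
  have : ContinuousAt (fun t : ℝ => x + t • v) 0 := by fun_prop
  exact this.eventually_mem (hU.mem_nhds (by simpa using hx))

theorem iteratedFDeriv_two_eq_dirD (hu : ContDiffOn ℝ (⊤ : ℕ∞) u U) (hU : IsOpen U)
    (m : Fin 2 → Euc n) {x : Euc n} (hx : x ∈ U) :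
    iteratedFDeriv ℝ 2 u x m = dirD (m 0) (dirD (m 1) u) x := by
  rw [iteratedFDeriv_two_apply, dirD_dirD hu hU _ _ hx]

theorem dotProduct_Hess_mulVec (hu : ContDiffOn ℝ (⊤ : ℕ∞) u U) (hU : IsOpen U) {x : Euc n}
    (hx : x ∈ U) (v w : Fin n → ℝ) :
    v ⬝ᵥ Matrix.mulVec (Hess u x) w
      = dirD (WithLp.toLp 2 v) (dirD (WithLp.toLp 2 w) u) x := by
  have hsum : ∀ v : Fin n → ℝ,
      (WithLp.toLp 2 v : Euc n) = ∑ i, v i • EuclideanSpace.single i (1 : ℝ) := by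
    intro v
    ext j
    simp [Finset.sum_apply, Pi.single_apply]
  rw [dirD_dirD hu hU _ _ hx, hsum v, hsum w]
  simp only [map_sum, map_smul, sum_apply, smul_apply,
    dotProduct, Matrix.mulVec, Hess, iteratedFDeriv_two_apply, Finset.mul_sum, smul_eq_mul]
  rw [Finset.sum_comm]
  refine Finset.sum_congr rfl fun i _ => Finset.sum_congr rfl fun j _ => ?_
  simp
  ring

theorem IsLocalMax.dirD_eq_zero {x : Euc n} (h : IsLocalMax u x) (v : Euc n) : dirD v u x = 0 := by
  rw [dirD, h.fderiv_eq_zero]; rfl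

theorem IsLocalMax.dirD_dirD_nonpos {x : Euc n} (h : IsLocalMax u x)
    (hu : ContDiffOn ℝ (⊤ : ℕ∞) u U) (hU : IsOpen U) (hx : x ∈ U) (v : Euc n) :
    dirD v (dirD v u) x ≤ 0 := by
  have hc : ContinuousAt (fun t : ℝ => x + t • v) 0 := by fun_prop
  have h1 : IsLocalMax (fun t : ℝ => u (x + t • v)) 0 := by
    have : Tendsto (fun t : ℝ => x + t • v) (𝓝 0) (𝓝 x) := by simpa [ContinuousAt] using hc
    have := this.eventually h
    simpa [IsLocalMax, IsMaxFilter] using this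
  have h2 := hasDerivAt_line (hu.dirD hU v) hU x v (t := 0) (by simpa using hx)
  have h3 := h1.second_deriv_nonpos ((eventually_line_mem hU hx v).mono fun t ht =>
    hasDerivAt_line hu hU x v ht) h2
  simpa using h3

theorem dirD_four_comm (hu : ContDiffOn ℝ (⊤ : ℕ∞) u U) (hU : IsOpen U) (v w : Euc n) {x : Euc n}
    (hx : x ∈ U) :
    dirD v (dirD v (dirD w (dirD w u))) x = dirD w (dirD w (dirD v (dirD v u))) x := by
  have e1 : EqOn (dirD v (dirD w (dirD w u))) (dirD w (dirD w (dirD v u))) U := fun y hy =>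
    (dirD_comm (hu.dirD hU w) hU v w hy).trans
      (dirD_congr (fun z hz => dirD_comm hu hU v w hz) hU w hy)
  have hv := hu.dirD hU v
  rw [dirD_congr e1 hU v hx, dirD_comm (hv.dirD hU w) hU v w hx]
  exact dirD_congr (fun y hy => dirD_comm hv hU v w hy) hU w hx

theorem norm_sq_dual_eq_sum (L : Euc n →L[ℝ] ℝ) :
    ‖L‖ ^ 2 = ∑ i, L (EuclideanSpace.single i 1) ^ 2 := by
  set g := (InnerProductSpace.toDual ℝ (Euc n)).symm L
  have hg : ∀ v, L v = ⟪g, v⟫ := fun v => by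
    simp [g, InnerProductSpace.toDual_symm_apply]
  have hn : ‖L‖ = ‖g‖ := by simp [g]
  rw [hn, EuclideanSpace.real_norm_sq_eq]
  refine Finset.sum_congr rfl fun i _ => ?_
  rw [hg, EuclideanSpace.inner_single_right]
  simp

/-- The Hessian norm of a convex function is attained on the diagonal. -/
theorem exists_norm_iteratedFDeriv_two_eq (hn : 0 < n) (hu : ContDiffOn ℝ (⊤ : ℕ∞) u U)
    (hU : IsOpen U) {x : Euc n} (hx : x ∈ U) (hpos : ∀ v, 0 ≤ dirD v (dirD v u) x) :
    ∃ ξ : Euc n, ‖ξ‖ = 1 ∧ ‖iteratedFDeriv ℝ 2 u x‖ ≤ dirD ξ (dirD ξ u) x := by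
  set B := fderiv ℝ (fderiv ℝ u) x with hB
  have hBD : ∀ v w, dirD v (dirD w u) x = B v w := fun v w => dirD_dirD hu hU v w hx
  have hsymm : ∀ v w, B v w = B w v := fun v w => by
    rw [← hBD, ← hBD, dirD_comm hu hU v w hx]
  have hne : (sphere (0 : Euc n) 1).Nonempty :=
    ⟨EuclideanSpace.single ⟨0, hn⟩ 1, by simp⟩
  obtain ⟨ξ, hξ, hmax⟩ := (isCompact_sphere (0 : Euc n) 1).exists_isMaxOn hne
    (f := fun v => B v v) (by fun_prop)
  have hξ1 : ‖ξ‖ = 1 := by simpa using hξ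
  refine ⟨ξ, hξ1, ?_⟩
  rw [hBD]
  have hM : 0 ≤ B ξ ξ := by rw [← hBD]; exact hpos ξ
  have hquad : ∀ v, B v v ≤ B ξ ξ * ‖v‖ ^ 2 := by
    intro v
    by_cases hv : v = 0
    · simp [hv]
    have hv' : ‖v‖ ≠ 0 := by simpa using hv
    have h := hmax (show (‖v‖⁻¹ • v) ∈ sphere (0 : Euc n) 1 by
      simp [norm_smul, hv'])
    simp only [mem_ofPred_eq, map_smul, smul_apply, smul_eq_mul] at h
    calc B v v = (‖v‖⁻¹ * (‖v‖⁻¹ * B v v)) * ‖v‖ ^ 2 := by field_simp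
      _ ≤ _ := by gcongr
  have hbil : ∀ v w : Euc n, ‖v‖ = 1 → ‖w‖ = 1 → B v w ≤ B ξ ξ := by
    intro v w hv hw
    have h1 := hquad (v + w)
    have h2 : 0 ≤ B (v - w) (v - w) := by rw [← hBD]; exact hpos _
    have h3 : ‖v + w‖ ^ 2 ≤ 4 := by
      have := norm_add_le v w
      rw [hv, hw] at this
      nlinarith [norm_nonneg (v + w)]
    have h4 : B (v + w) (v + w) - B (v - w) (v - w) = 4 * B v w := by
      simp only [map_add, map_sub, add_apply, sub_apply,
        hsymm w v]
      ring
    nlinarith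
  have habs : ∀ v w : Euc n, ‖B v w‖ ≤ B ξ ξ * ‖v‖ * ‖w‖ := by
    intro v w
    by_cases hv : v = 0
    · simp [hv]
    by_cases hw : w = 0
    · simp [hw]
    have hv' : ‖v‖ ≠ 0 := by simpa using hv
    have hw' : ‖w‖ ≠ 0 := by simpa using hw
    have h1 : ‖(‖v‖⁻¹ • v)‖ = 1 := by simp [norm_smul, hv']
    have h2 : ‖(‖w‖⁻¹ • w)‖ = 1 := by simp [norm_smul, hw']
    have h3 := hbil _ _ h1 h2
    have h4 := hbil (-(‖v‖⁻¹ • v)) _ (by rw [norm_neg, h1]) h2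
    simp only [map_neg, map_smul, smul_apply, smul_eq_mul,
      neg_apply] at h3 h4
    have h5 : B v w = (‖w‖⁻¹ * (‖v‖⁻¹ * B v w)) * (‖v‖ * ‖w‖) := by field_simp
    rw [Real.norm_eq_abs, h5, abs_mul, abs_of_nonneg (a := ‖v‖ * ‖w‖) (by positivity), mul_assoc]
    gcongr
    exact abs_le.mpr ⟨by linarith, by linarith⟩
  refine ContinuousMultilinearMap.opNorm_le_bound hM fun m => ?_
  rw [iteratedFDeriv_two_apply, Fin.prod_univ_two, ← mul_assoc]
  exact habs _ _

end DirectionalDerivative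

section HessianEstimate

variable {n : ℕ} {U : Set (Euc n)} {u : Euc n → ℝ}

theorem dirD_dirD_pos_of_posDef (hu : ContDiffOn ℝ (⊤ : ℕ∞) u U) (hU : IsOpen U) {x : Euc n}
    (hx : x ∈ U) (h : (Hess u x).PosDef) {v : Euc n} (hv : v ≠ 0) : 0 < dirD v (dirD v u) x := by
  have hv' : v.ofLp ≠ 0 := by simpa using hv
  have := h.dotProduct_mulVec_pos hv'
  rwa [star_trivial, dotProduct_Hess_mulVec hu hU hx] at this

theorem dirD_dirD_nonneg_of_posDef (hu : ContDiffOn ℝ (⊤ : ℕ∞) u U) (hU : IsOpen U) {x : Euc n}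
    (hx : x ∈ U) (h : (Hess u x).PosDef) (v : Euc n) : 0 ≤ dirD v (dirD v u) x := by
  by_cases hv : v = 0
  · rw [dirD_dirD hu hU _ _ hx, hv]; simp
  · exact (dirD_dirD_pos_of_posDef hu hU hx h hv).le

theorem exists_hessian_frame (hn : 0 < n) (hu : ContDiffOn ℝ (⊤ : ℕ∞) u U) (hU : IsOpen U)
    {x : Euc n} (hx : x ∈ U) (hA : (Hess u x).PosDef) :
    ∃ (η : Fin n → Euc n) (d : ℝ), 0 < d ∧ (Hess u x).det * d = 1 ∧
      ∑ k, dirD (η k) (dirD (η k) u) x = n ∧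
      (∀ (w : Euc n → ℝ) (W : Set (Euc n)), ContDiffOn ℝ (⊤ : ℕ∞) w W → IsOpen W → ∀ y ∈ W,
        (Hess w y).PosDef →
          (Hess w y).det * d ≤ ((∑ k, dirD (η k) (dirD (η k) w) y) / n) ^ n) ∧
      ∀ e : Euc n, ‖e‖ ^ 4 ≤ dirD e (dirD e u) x * ∑ k, ⟪e, η k⟫ ^ 2 := by
  obtain ⟨η, d, hd, h1, h2, h3, h4⟩ := exists_orthonormal_frame hn hA
  refine ⟨fun k => WithLp.toLp 2 (η k), d, hd, h1, ?_, ?_, ?_⟩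
  · simpa only [dotProduct_Hess_mulVec hu hU hx] using h2
  · intro w W hw hW y hy hP
    simpa only [dotProduct_Hess_mulVec hw hW hy] using h3 _ hP.posSemidef
  · intro e
    have := h4 e.ofLp
    rw [dotProduct_Hess_mulVec hu hU hx] at this
    have h5 : e.ofLp ⬝ᵥ e.ofLp = ‖e‖ ^ 2 := by
      rw [EuclideanSpace.real_norm_sq_eq]; simp [dotProduct, sq]
    rw [h5, ← pow_mul] at this
    refine this.trans (le_of_eq ?_)
    congr 1
    refine Finset.sum_congr rfl fun k _ => ?_
    rw [EuclideanSpace.inner_eq_star_dotProduct, star_trivial, dotProduct_comm]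

theorem log_det_eq {f : Euc n → ℝ → ℝ} {x : Euc n} (hK : gaussK u x = f x (u x))
    (hf : 0 < f x (u x)) :
    Real.log (Hess u x).det =
      Real.log (f x (u x)) + ((n : ℝ) + 2) / 2 * Real.log (1 + ‖fderiv ℝ u x‖ ^ 2) := by
  have hV : 0 < 1 + ‖fderiv ℝ u x‖ ^ 2 := by positivity
  have hVp := Real.rpow_pos_of_pos hV (((n : ℝ) + 2) / 2)
  have : (Hess u x).det = f x (u x) * (1 + ‖fderiv ℝ u x‖ ^ 2) ^ (((n : ℝ) + 2) / 2) := by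
    rw [← hK, gaussK, div_mul_cancel₀ _ hVp.ne']
  rw [this, Real.log_mul hf.ne' hVp.ne', Real.log_rpow hV]

theorem le_of_quadratic_le {V m G H Q : ℝ} (hV : 1 ≤ V) (hG : 0 ≤ G) (hH : 0 ≤ H)
    (h5 : m ^ 2 = Q * V) (hfin : 2 * Q ≤ H + G ^ 2 + 4 * G * m) :
    m ≤ 1 + V * (H + G ^ 2 + 4 * G) := by
  have hV0 : 0 < V := by linarith
  by_contra! hcon
  have hnn : 0 ≤ V * (H + G ^ 2 + 4 * G) := by positivity
  have hm1 : 1 ≤ m := by linarith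
  have h6 : H + G ^ 2 + 4 * G * m ≤ (H + G ^ 2 + 4 * G) * m := by
    have : H + G ^ 2 ≤ (H + G ^ 2) * m := le_mul_of_one_le_right (by positivity) hm1
    linarith
  have h7 : 2 * m ^ 2 ≤ V * (H + G ^ 2 + 4 * G) * m := by
    rw [h5]
    calc 2 * (Q * V) = V * (2 * Q) := by ring
      _ ≤ V * ((H + G ^ 2 + 4 * G) * m) := mul_le_mul_of_nonneg_left (hfin.trans h6) hV0.le
      _ = _ := by ring
  have h8 : V * (H + G ^ 2 + 4 * G) * m < m * m := by
    apply mul_lt_mul_of_pos_right _ (by linarith)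
    linarith
  nlinarith

set_option maxHeartbeats 800000 in
/-- The algebra behind the second derivative estimate. -/
theorem second_order_algebra {N F F1 F2 V V1 m G H T1 : ℝ} (hN : 2 ≤ N) (hF : 0 < F) (hV : 1 ≤ V)
    (hm : 0 ≤ m) (hG : 0 ≤ G) (hH : 0 ≤ H) (hF1 : |F1| ≤ G * F) (hF2 : -(H * F) ≤ F2)
    (hV1 : V1 ^ 2 ≤ 4 * (V - 1) * m ^ 2)
    (h1 : F1 / F + (N + 2) / 2 * (V1 / V) - T1 = 0)
    (h2 : (F2 * F - F1 * F1) / F ^ 2 + (N + 2) / 2 * ((2 * m ^ 2 * V - V1 * V1) / V ^ 2)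
      + T1 ^ 2 / N ≤ 0) :
    m ≤ 1 + V * (H + G ^ 2 + 4 * G) := by
  have hV0 : 0 < V := by linarith
  have hN0 : 0 < N := by linarith
  set g := F1 / F with hg
  set r := V1 / V with hr
  have hgG : |g| ≤ G := by
    rw [hg, abs_div, abs_of_pos hF, div_le_iff₀ hF]; exact hF1
  have hg2 : g ^ 2 ≤ G ^ 2 := by rw [← sq_abs]; gcongr
  have hq : (F2 * F - F1 * F1) / F ^ 2 = F2 / F - g ^ 2 := by rw [hg]; field_simp
  have hq2 : -H ≤ F2 / F := by rw [le_div_iff₀ hF]; linarith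
  have hs : (2 * m ^ 2 * V - V1 * V1) / V ^ 2 = 2 * (m ^ 2 / V) - r ^ 2 := by rw [hr]; field_simp
  set Q := m ^ 2 / V with hQ
  have hQ0 : 0 ≤ Q := by positivity
  have hr2 : r ^ 2 ≤ 4 * Q := by
    rw [hr, hQ, div_pow, div_le_iff₀ (by positivity)]
    have : 4 * (m ^ 2 / V) * V ^ 2 = 4 * V * m ^ 2 := by field_simp
    rw [this]; nlinarith [sq_nonneg m]
  have hQm : Q ≤ m ^ 2 := by
    rw [hQ, div_le_iff₀ hV0]; nlinarith [sq_nonneg m]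
  have hrm : |r| ≤ 2 * m := by
    apply abs_le_of_sq_le_sq _ (by positivity)
    nlinarith
  have hT : T1 = g + (N + 2) / 2 * r := by linarith
  rw [hq, hs, hT] at h2
  have hgr : -(G * (2 * m)) ≤ g * r := by
    have : |g * r| ≤ G * (2 * m) := by
      rw [abs_mul]; exact mul_le_mul hgG hrm (abs_nonneg _) hG
    exact (abs_le.mp this).1
  have hexp : (g + (N + 2) / 2 * r) ^ 2 / N
      = g ^ 2 / N + (N + 2) / N * (g * r) + ((N + 2) / 2) * ((N + 2) / (2 * N)) * r ^ 2 := by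
    field_simp; ring
  rw [hexp] at h2
  have hb : (N + 2) / N ≤ 2 := by rw [div_le_iff₀ hN0]; linarith
  have hb0 : 0 ≤ (N + 2) / N := by positivity
  have hb1 : 1 ≤ (N + 2) / N := by rw [le_div_iff₀ hN0]; linarith
  have hc : (N + 2) / (2 * N) = (N + 2) / N / 2 := by field_simp
  rw [hc] at h2
  set β := (N + 2) / N with hβ
  have hNβ : N * β = N + 2 := by rw [hβ]; field_simp
  have hcross : -(4 * G * m) ≤ β * (g * r) := by
    have h3 : β * (G * (2 * m)) ≤ 2 * (G * (2 * m)) :=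
      mul_le_mul_of_nonneg_right hb (by positivity)
    have h4 := mul_le_mul_of_nonneg_left hgr hb0
    linarith
  have hgN : 0 ≤ g ^ 2 / N := by positivity
  have hrr : (N + 2) / 2 * (1 - β / 2) * r ^ 2 ≤ (N + 2) / 2 * (1 - β / 2) * (4 * Q) := by
    apply mul_le_mul_of_nonneg_left hr2
    apply mul_nonneg <;> linarith
  have hmain : (N + 2) / 2 * (2 * Q) - (N + 2) / 2 * (1 - β / 2) * (4 * Q) = (N + 2) * (β - 1) * Q
    := by ring
  have hmain2 : (N + 2) * (β - 1) = 2 * β := by linear_combination hNβ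
  have hfin : 2 * Q ≤ H + G ^ 2 + 4 * G * m := by
    have h3 : 2 * Q ≤ 2 * β * Q := by
      rw [mul_assoc]; linarith [mul_le_mul_of_nonneg_right hb1 hQ0]
    rw [hmain2] at hmain
    have h4 : (N + 2) / 2 * (2 * Q - r ^ 2) + (N + 2) / 2 * (β / 2) * r ^ 2
        = (N + 2) / 2 * (2 * Q) - (N + 2) / 2 * (1 - β / 2) * r ^ 2 := by ring
    linarith
  exact le_of_quadratic_le hV hG hH (by rw [hQ]; field_simp) hfin

/-- First and second derivative of `f(·,u)` along a line. -/
theorem hasDerivAt_source_line {f : Euc n → ℝ → ℝ} (hu : ContDiffOn ℝ (⊤ : ℕ∞) u U) (hU : IsOpen U)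
    (hf : ContDiffOn ℝ (⊤ : ℕ∞) (fun p : Euc n × ℝ => f p.1 p.2) (U ×ˢ univ))
    {x : Euc n} (hx : x ∈ U) (ξ : Euc n) (hξ : ‖ξ‖ = 1) {C₀ C₁ : ℝ}
    (hconv : 0 ≤ dirD ξ (dirD ξ u) x) (hmono : Monotone (f x))
    (hgrad : ‖fderiv ℝ u x‖ ≤ C₀)
    (hder : ‖fderiv ℝ (fun p : Euc n × ℝ => f p.1 p.2) (x, u x)‖ +
      ‖iteratedFDeriv ℝ 2 (fun p : Euc n × ℝ => f p.1 p.2) (x, u x)‖ ≤ C₁ * f x (u x)) :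
    ∃ (F1 : ℝ → ℝ) (F2 : ℝ),
      (∀ᶠ t in 𝓝 0, HasDerivAt (fun s : ℝ => f (x + s • ξ) (u (x + s • ξ))) (F1 t) t) ∧
      HasDerivAt F1 F2 0 ∧ |F1 0| ≤ C₁ * (1 + C₀) * f x (u x) ∧
      -(C₁ * (1 + C₀) ^ 2 * f x (u x)) ≤ F2 := by
  set g : Euc n × ℝ → ℝ := fun p => f p.1 p.2 with hg
  have hO : IsOpen (U ×ˢ (univ : Set ℝ)) := hU.prod isOpen_univ
  set γ : ℝ → Euc n × ℝ := fun t => (x + t • ξ, u (x + t • ξ)) with hγ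
  set γ' : ℝ → Euc n × ℝ := fun t => (ξ, dirD ξ u (x + t • ξ)) with hγ'
  have hγ0 : γ 0 = (x, u x) := by simp [hγ]
  have hγ'0 : γ' 0 = (ξ, dirD ξ u x) := by simp [hγ']
  have hline : ∀ t : ℝ, HasDerivAt (fun s : ℝ => x + s • ξ) ξ t := fun t => by
    simpa using ((hasDerivAt_id t).smul_const ξ).const_add x
  have hγd : ∀ t : ℝ, x + t • ξ ∈ U → HasDerivAt γ (γ' t) t := fun t ht =>
    (hline t).prodMk (hasDerivAt_line hu hU x ξ ht)
  have hx0 : x + (0 : ℝ) • ξ ∈ U := by simpa using hx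
  have hγ'd : HasDerivAt γ' (0, dirD ξ (dirD ξ u) x) 0 := by
    have := hasDerivAt_line (hu.dirD hU ξ) hU x ξ hx0
    simpa using (hasDerivAt_const (0 : ℝ) ξ).prodMk this
  have hfd : ∀ y ∈ U, ∀ z, DifferentiableAt ℝ g (y, z) := fun y hy z =>
    (hf.contDiffAt (hO.mem_nhds ⟨hy, mem_univ _⟩)).differentiableAt (by simp)
  have hfd2 : DifferentiableAt ℝ (fderiv ℝ g) (x, u x) :=
    ((hf.fderiv_of_isOpen (m := (⊤ : ℕ∞)) hO (by simp)).contDiffAt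
      (hO.mem_nhds ⟨hx, mem_univ _⟩)).differentiableAt (by simp)
  have hF2 : HasDerivAt (fun t => fderiv ℝ g (γ t) (γ' t))
      (fderiv ℝ (fderiv ℝ g) (x, u x) (ξ, dirD ξ u x) (ξ, dirD ξ u x)
        + fderiv ℝ g (x, u x) (0, dirD ξ (dirD ξ u) x)) 0 := by
    have h1 : HasDerivAt (fun t => fderiv ℝ g (γ t))
        (fderiv ℝ (fderiv ℝ g) (x, u x) (ξ, dirD ξ u x)) 0 := by
      rw [← hγ0, ← hγ'0]
      rw [← hγ0] at hfd2
      exact hfd2.hasFDerivAt.comp_hasDerivAt 0 (hγd 0 hx0)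
    have h2 := h1.clm_apply hγ'd
    rwa [hγ0, hγ'0] at h2
  have hu1 : |dirD ξ u x| ≤ C₀ := by
    have := (fderiv ℝ u x).le_opNorm ξ
    rw [hξ, mul_one] at this
    exact this.trans hgrad
  have hC₀ : 0 ≤ C₀ := (abs_nonneg _).trans hu1
  have hnorm : ‖(ξ, dirD ξ u x)‖ ≤ 1 + C₀ := by
    rw [Prod.norm_def]
    refine max_le ?_ ?_
    · simp only [hξ]; linarith
    · simp only [Real.norm_eq_abs]; linarith
  have hz : 0 ≤ fderiv ℝ g (x, u x) (0, 1) := by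
    have h1 : HasDerivAt (fun z : ℝ => (x, z)) ((0 : Euc n), (1 : ℝ)) (u x) :=
      (hasDerivAt_const (u x) x).prodMk (hasDerivAt_id (u x))
    have h2 : HasDerivAt (f x) (fderiv ℝ g (x, u x) (0, 1)) (u x) :=
      (hfd x hx (u x)).hasFDerivAt.comp_hasDerivAt (u x) h1
    rw [← h2.deriv]
    exact hmono.deriv_nonneg
  have hfn : 0 ≤ C₁ * f x (u x) := le_trans (by positivity) hder
  have hD1 : ‖fderiv ℝ g (x, u x)‖ ≤ C₁ * f x (u x) := by
    linarith [norm_nonneg (iteratedFDeriv ℝ 2 g (x, u x))]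
  have hD2 : ‖iteratedFDeriv ℝ 2 g (x, u x)‖ ≤ C₁ * f x (u x) := by
    linarith [norm_nonneg (fderiv ℝ g (x, u x))]
  refine ⟨fun t => fderiv ℝ g (γ t) (γ' t), _, ?_, hF2, ?_, ?_⟩
  · filter_upwards [eventually_line_mem hU hx ξ] with t ht
    exact HasFDerivAt.comp_hasDerivAt (f := γ) t (hfd _ ht (u (x + t • ξ))).hasFDerivAt (hγd t ht)
  · simp only [hγ0, hγ'0]
    calc |fderiv ℝ g (x, u x) (ξ, dirD ξ u x)|
        ≤ ‖fderiv ℝ g (x, u x)‖ * ‖(ξ, dirD ξ u x)‖ := (fderiv ℝ g (x, u x)).le_opNorm _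
      _ ≤ (C₁ * f x (u x)) * (1 + C₀) := by gcongr
      _ = _ := by ring
  · have h1 : fderiv ℝ g (x, u x) (0, dirD ξ (dirD ξ u) x)
        = dirD ξ (dirD ξ u) x * fderiv ℝ g (x, u x) (0, 1) := by
      rw [← smul_eq_mul, ← map_smul]; simp
    have h2 : |fderiv ℝ (fderiv ℝ g) (x, u x) (ξ, dirD ξ u x) (ξ, dirD ξ u x)|
        ≤ C₁ * (1 + C₀) ^ 2 * f x (u x) := by
      have h3 := (iteratedFDeriv ℝ 2 g (x, u x)).le_opNorm ![(ξ, dirD ξ u x), (ξ, dirD ξ u x)]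
      rw [iteratedFDeriv_two_apply] at h3
      simp only [Matrix.cons_val_zero, Matrix.cons_val_one, Fin.prod_univ_two,
        Real.norm_eq_abs] at h3
      calc _ ≤ _ := h3
        _ ≤ (C₁ * f x (u x)) * ((1 + C₀) * (1 + C₀)) := by gcongr
        _ = _ := by ring
    rw [h1]
    have := (abs_le.mp h2).1
    have := mul_nonneg hconv hz
    linarith

/-- At an interior maximum of the Hessian norm of a convex solution, the Hessian is bounded in terms
of the gradient and the source term. -/
theorem hessian_norm_le_of_interior_max {f : Euc n → ℝ → ℝ} (hn : 2 ≤ n) (hU : IsOpen U)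
    (hu : ContDiffOn ℝ (⊤ : ℕ∞) u U) (hP : ∀ y ∈ U, (Hess u y).PosDef)
    (hf : ContDiffOn ℝ (⊤ : ℕ∞) (fun p : Euc n × ℝ => f p.1 p.2) (U ×ˢ univ))
    (hfpos : ∀ y ∈ U, ∀ z, 0 < f y z) (hK : ∀ y ∈ U, gaussK u y = f y (u y))
    {x : Euc n} (hx : x ∈ U) (hmono : Monotone (f x)) {C₀ C₁ : ℝ} (hC₁ : 0 ≤ C₁)
    (hgrad : ‖fderiv ℝ u x‖ ≤ C₀)
    (hder : ‖fderiv ℝ (fun p : Euc n × ℝ => f p.1 p.2) (x, u x)‖ +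
      ‖iteratedFDeriv ℝ 2 (fun p : Euc n × ℝ => f p.1 p.2) (x, u x)‖ ≤ C₁ * f x (u x))
    (hmax : ∀ y ∈ U, ‖iteratedFDeriv ℝ 2 u y‖ ≤ ‖iteratedFDeriv ℝ 2 u x‖) :
    ‖iteratedFDeriv ℝ 2 u x‖ ≤ 1 + (1 + C₀ ^ 2) *
      (C₁ * (1 + C₀) ^ 2 + (C₁ * (1 + C₀)) ^ 2 + 4 * (C₁ * (1 + C₀))) := by
  have hn0 : 0 < n := by omega
  have hnR : (0 : ℝ) < n := by exact_mod_cast hn0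
  have hC₀ : 0 ≤ C₀ := (norm_nonneg _).trans hgrad
  obtain ⟨ξ, hξ, hM⟩ := exists_norm_iteratedFDeriv_two_eq hn0 hu hU hx
    (dirD_dirD_nonneg_of_posDef hu hU hx (hP x hx))
  set w := dirD ξ (dirD ξ u) with hw
  have hwU : ContDiffOn ℝ (⊤ : ℕ∞) w U := (hu.dirD hU ξ).dirD hU ξ
  have hwmax : IsLocalMax w x := by
    filter_upwards [hU.mem_nhds hx] with y hy
    have h := (iteratedFDeriv ℝ 2 u y).le_opNorm ![ξ, ξ]
    rw [iteratedFDeriv_two_eq_dirD hu hU _ hy] at h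
    simp only [Matrix.cons_val_zero, Matrix.cons_val_one, Fin.prod_univ_two, hξ, mul_one,
      Real.norm_eq_abs] at h
    exact (le_abs_self _).trans (h.trans ((hmax y hy).trans hM))
  obtain ⟨η, d, hd, hdet1, htr, hamgm, -⟩ := exists_hessian_frame hn0 hu hU hx (hP x hx)
  have hx0 : x + (0 : ℝ) • ξ ∈ U := by simpa using hx
  have hmem := eventually_line_mem hU hx ξ
  obtain ⟨F1, F2, hFd, hF1d, hF1b, hF2b⟩ := hasDerivAt_source_line hu hU hf hx ξ hξ
    (dirD_dirD_nonneg_of_posDef hu hU hx (hP x hx) ξ) hmono hgrad hder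
  set F : ℝ → ℝ := fun s => f (x + s • ξ) (u (x + s • ξ)) with hF
  have hF0 : F 0 = f x (u x) := by simp [hF]
  set e : Fin n → Euc n := fun i => EuclideanSpace.single i (1 : ℝ) with he
  set p : Fin n → ℝ → ℝ := fun i t => dirD (e i) u (x + t • ξ) with hp
  set q : Fin n → ℝ → ℝ := fun i t => dirD ξ (dirD (e i) u) (x + t • ξ) with hq
  have hpd : ∀ i, ∀ t : ℝ, x + t • ξ ∈ U → HasDerivAt (p i) (q i t) t := fun i t ht =>
    hasDerivAt_line (hu.dirD hU (e i)) hU x ξ ht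
  have hqd : ∀ i, HasDerivAt (q i) 0 0 := fun i => by
    have h := hasDerivAt_line ((hu.dirD hU (e i)).dirD hU ξ) hU x ξ hx0
    have h2 : dirD ξ (dirD ξ (dirD (e i) u)) x = 0 := by
      rw [dirD_congr (fun y hy => dirD_comm hu hU ξ (e i) hy) hU ξ hx,
        dirD_comm (hu.dirD hU ξ) hU ξ (e i) hx]
      exact hwmax.dirD_eq_zero (e i)
    rwa [zero_smul, add_zero, h2] at h
  set V : ℝ → ℝ := fun t => 1 + ∑ i, p i t ^ 2 with hV
  set V1 : ℝ → ℝ := fun t => ∑ i, 2 * (p i t * q i t) with hV1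
  have hVeq : ∀ t, V t = 1 + ‖fderiv ℝ u (x + t • ξ)‖ ^ 2 := fun t => by
    rw [norm_sq_dual_eq_sum]; rfl
  have hVpos : ∀ t, 0 < V t := fun t => by rw [hVeq]; positivity
  have hVd : ∀ t : ℝ, x + t • ξ ∈ U → HasDerivAt V (V1 t) t := fun t ht => by
    have := (HasDerivAt.fun_sum (u := Finset.univ) fun i _ => (hpd i t ht).pow 2).const_add 1
    refine this.congr_deriv (Finset.sum_congr rfl fun i _ => ?_)
    simp; ring
  set m : ℝ := Real.sqrt (∑ i, q i 0 ^ 2) with hm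
  have hm2 : m ^ 2 = ∑ i, q i 0 ^ 2 := Real.sq_sqrt (Finset.sum_nonneg fun i _ => sq_nonneg _)
  have hV1d : HasDerivAt V1 (2 * m ^ 2) 0 := by
    have := HasDerivAt.fun_sum (u := Finset.univ) fun i _ =>
      ((hpd i 0 hx0).mul (hqd i)).const_mul 2
    refine this.congr_deriv ?_
    rw [hm2, Finset.mul_sum]
    refine Finset.sum_congr rfl fun i _ => ?_
    ring
  have hV1sq : V1 0 ^ 2 ≤ 4 * (V 0 - 1) * m ^ 2 := by
    have h := Finset.sum_mul_sq_le_sq_mul_sq Finset.univ (fun i => p i 0) (fun i => q i 0)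
    have h1 : V1 0 = 2 * ∑ i, p i 0 * q i 0 := by rw [hV1, Finset.mul_sum]
    have h2 : V 0 - 1 = ∑ i, p i 0 ^ 2 := by simp [hV]
    rw [h1, h2, hm2]
    nlinarith
  have hMm : ‖iteratedFDeriv ℝ 2 u x‖ ≤ m := by
    refine hM.trans ?_
    set L := fderiv ℝ (dirD ξ u) x with hL
    have h1 : w x = L ξ := rfl
    have h2 : ‖L‖ ^ 2 = m ^ 2 := by
      rw [hm2, norm_sq_dual_eq_sum]
      refine Finset.sum_congr rfl fun i _ => ?_
      simp only [hq, zero_smul, add_zero]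
      rw [dirD_comm hu hU ξ (e i) hx]
      rfl
    have h3 : ‖L‖ = m := (sq_eq_sq₀ (norm_nonneg _) (Real.sqrt_nonneg _)).mp h2
    have h4 := L.le_opNorm ξ
    rw [hξ, mul_one, h3] at h4
    exact (le_abs_self _).trans h4
  set τ : ℝ → ℝ := fun t => ∑ k, dirD (η k) (dirD (η k) u) (x + t • ξ) with hτ
  set τ1 : ℝ → ℝ := fun t => ∑ k, dirD ξ (dirD (η k) (dirD (η k) u)) (x + t • ξ) with hτ1
  have hτ0 : τ 0 = n := by simpa [hτ] using htr
  have hτd : ∀ t : ℝ, x + t • ξ ∈ U → HasDerivAt τ (τ1 t) t := fun t ht =>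
    HasDerivAt.fun_sum fun k _ =>
      hasDerivAt_line ((hu.dirD hU (η k)).dirD hU (η k)) hU x ξ ht
  obtain ⟨τ2, hτ1d, hτ2⟩ : ∃ τ2, HasDerivAt τ1 τ2 0 ∧ τ2 ≤ 0 := by
    refine ⟨_, HasDerivAt.fun_sum fun k _ =>
      hasDerivAt_line (((hu.dirD hU (η k)).dirD hU (η k)).dirD hU ξ) hU x ξ hx0, ?_⟩
    refine Finset.sum_nonpos fun k _ => ?_
    rw [zero_smul, add_zero, dirD_four_comm hu hU ξ (η k) hx]
    exact hwmax.dirD_dirD_nonpos hwU hU hx (η k)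
  have hτpos : ∀ᶠ t in 𝓝 0, 0 < τ t :=
    (hτd 0 hx0).continuousAt.eventually_const_lt (by rw [hτ0]; exact hnR)
  have hFpos : ∀ t : ℝ, x + t • ξ ∈ U → 0 < F t := fun t ht => hfpos _ ht _
  set b : ℝ := ((n : ℝ) + 2) / 2 with hb
  set Φ : ℝ → ℝ := fun t => Real.log (F t) + b * Real.log (V t) - n * Real.log (τ t) with hΦ
  set Φ1 : ℝ → ℝ := fun t => F1 t / F t + b * (V1 t / V t) - n * (τ1 t / τ t) with hΦ1
  have hlogdet : ∀ t : ℝ, x + t • ξ ∈ U →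
      Real.log (Hess u (x + t • ξ)).det = Real.log (F t) + b * Real.log (V t) := fun t ht => by
    rw [log_det_eq (hK _ ht) (hfpos _ ht _), hVeq]
  have hΦmax : IsLocalMax Φ 0 := by
    filter_upwards [hmem, hτpos] with t ht htτ
    have hdt := (hP _ ht).det_pos
    have hle := Real.log_le_log (mul_pos hdt hd) (hamgm u U hu hU _ ht (hP _ ht))
    have h0 := hlogdet 0 hx0
    have h1 : Real.log (Hess u x).det + Real.log d = 0 := by
      rw [← Real.log_mul (hP x hx).det_pos.ne' hd.ne', hdet1, Real.log_one]
    change Real.log _ ≤ Real.log ((τ t / n) ^ n) at hle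
    rw [Real.log_mul hdt.ne' hd.ne', hlogdet t ht, Real.log_pow,
      Real.log_div htτ.ne' hnR.ne'] at hle
    rw [zero_smul, add_zero] at h0
    simp only [hΦ, hτ0]
    linarith
  have hΦd : ∀ᶠ t in 𝓝 0, HasDerivAt Φ (Φ1 t) t := by
    filter_upwards [hmem, hτpos, hFd] with t ht htτ htF
    exact ((htF.log (hFpos t ht).ne').add (((hVd t ht).log (hVpos t).ne').const_mul b)).sub
      (((hτd t ht).log htτ.ne').const_mul (n : ℝ))
  have hτ0' : τ 0 ≠ 0 := by rw [hτ0]; exact hnR.ne'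
  have hΦ1d := ((hF1d.div hFd.self_of_nhds (hFpos 0 hx0).ne').add
    ((hV1d.div (hVd 0 hx0) (hVpos 0).ne').const_mul b)).sub
      ((hτ1d.div (hτd 0 hx0) hτ0').const_mul (n : ℝ))
  have hfirst := hΦmax.hasDerivAt_eq_zero hΦd.self_of_nhds
  have hsecond := hΦmax.second_deriv_nonpos hΦd hΦ1d
  simp only [hΦ1] at hfirst
  rw [hτ0] at hfirst hsecond
  have hT : (n : ℝ) * (τ1 0 / n) = τ1 0 := by field_simp
  have hT2 : (n : ℝ) * ((τ2 * n - τ1 0 * τ1 0) / (n : ℝ) ^ 2) = τ2 - τ1 0 ^ 2 / n := by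
    field_simp
  rw [hT] at hfirst
  rw [hT2] at hsecond
  have hV01 : 1 ≤ V 0 := by rw [hVeq]; nlinarith [norm_nonneg (fderiv ℝ u (x + (0 : ℝ) • ξ))]
  have hV0C : V 0 ≤ 1 + C₀ ^ 2 := by
    rw [hVeq, zero_smul, add_zero]
    gcongr
  rw [← hF0] at hF1b hF2b
  rw [hb] at hsecond
  have hm0 : 0 ≤ m := Real.sqrt_nonneg _
  have key := second_order_algebra (N := n) (m := m) (by exact_mod_cast hn) (hFpos 0 hx0) hV01
    hm0 (by positivity) (by positivity) hF1b hF2b hV1sq hfirst (by linarith)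
  refine (hMm.trans key).trans ?_
  gcongr

end HessianEstimate

theorem exists_convex_pos {E : Type*} [NormedAddCommGroup E] [NormedSpace ℝ E] {g : E → ℝ} {y : E}
    (hg : DifferentiableAt ℝ g y) (h0 : fderiv ℝ g y ≠ 0) (hy : 0 ≤ g y) {N : Set E}
    (hN : N ∈ 𝓝 y) :
    ∃ T : Set E, Convex ℝ T ∧ IsOpen T ∧ y ∈ closure T ∧ T ⊆ N ∧ ∀ z ∈ T, 0 < g z := by
  set L := fderiv ℝ g y with hL
  have hL0 : 0 < ‖L‖ := norm_pos_iff.mpr h0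
  have hlit := hg.hasFDerivAt.isLittleO.def (half_pos hL0)
  obtain ⟨r, hr, hball⟩ := Metric.mem_nhds_iff.mp (inter_mem hlit hN)
  refine ⟨{z | ‖L‖ / 2 * ‖z - y‖ - L (z - y) < 0} ∩ ball y r, ?_, ?_, ?_, ?_, ?_⟩
  · refine Convex.inter ?_ (convex_ball y r)
    have hc : ConvexOn ℝ univ (fun z => ‖L‖ / 2 * ‖z - y‖ - L (z - y)) := by
      refine ⟨convex_univ, fun a _ b _ s t hs ht hst => ?_⟩
      have h1 : s • a + t • b - y = s • (a - y) + t • (b - y) := by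
        have : y = s • y + t • y := by rw [← add_smul, hst, one_smul]
        nth_rewrite 1 [this]
        simp only [smul_sub]; abel
      have h2 : ‖s • (a - y) + t • (b - y)‖ ≤ s * ‖a - y‖ + t * ‖b - y‖ := by
        refine (norm_add_le _ _).trans ?_
        rw [norm_smul, norm_smul, Real.norm_of_nonneg hs, Real.norm_of_nonneg ht]
      simp only [h1, map_add, map_smul, smul_eq_mul]
      nlinarith
    simpa using hc.convex_lt 0
  · exact (isOpen_lt (by fun_prop) (by fun_prop)).inter isOpen_ball
  · obtain ⟨v, hv0, hv⟩ := L.exists_lt_apply_of_lt_opNorm (half_lt_self hL0)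
    obtain ⟨w, hw⟩ : ∃ w, ‖L‖ / 2 * ‖w‖ < L w := by
      have hv1 : ‖L‖ / 2 * ‖v‖ < |L v| := by
        rw [Real.norm_eq_abs] at hv
        nlinarith [norm_nonneg v]
      rcases abs_cases (L v) with h | h
      · exact ⟨v, by linarith⟩
      · exact ⟨-v, by rw [norm_neg, map_neg]; linarith⟩
    have hc : Tendsto (fun t : ℝ => y + t • w) (𝓝[>] 0) (𝓝 y) := by
      have : ContinuousAt (fun t : ℝ => y + t • w) 0 := by fun_prop
      have h2 : Tendsto (fun t : ℝ => y + t • w) (𝓝 0) (𝓝 y) := by simpa [ContinuousAt] using this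
      exact h2.mono_left nhdsWithin_le_nhds
    refine mem_closure_of_tendsto hc ?_
    filter_upwards [hc.eventually (ball_mem_nhds y hr), self_mem_nhdsWithin] with t ht ht0
    refine ⟨?_, ht⟩
    have ht0 : 0 < t := ht0
    simp only [mem_ofPred_eq, add_sub_cancel_left, norm_smul, map_smul, smul_eq_mul,
      Real.norm_of_nonneg ht0.le]
    nlinarith
  · exact fun z hz => (hball hz.2).2
  · rintro z ⟨hz, hzb⟩
    have h1 : ‖g z - g y - L (z - y)‖ ≤ ‖L‖ / 2 * ‖z - y‖ := (hball hzb).1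
    have h2 : ‖L‖ / 2 * ‖z - y‖ - L (z - y) < 0 := hz
    have h3 := (abs_le.mp h1).1
    linarith

theorem uniqueDiffOn_diff_interior_sublevel {E : Type*} [NormedAddCommGroup E] [NormedSpace ℝ E]
    {g : E → ℝ} (hg : Differentiable ℝ g) (h0 : ∀ x ∈ frontier {x | g x ≤ 0}, fderiv ℝ g x ≠ 0)
    {s : Set E} (hs : Convex ℝ s) (hK : {x | g x ≤ 0} ⊆ interior s)
    (hsne : (interior s).Nonempty) :
    UniqueDiffOn ℝ (s \ interior {x | g x ≤ 0}) := by
  set K := {x | g x ≤ 0} with hKdef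
  have hKc : IsClosed K := isClosed_le hg.continuous continuous_const
  intro y hy
  by_cases hyK : y ∈ K
  · have hyf : y ∈ frontier K := ⟨subset_closure hyK, hy.2⟩
    have hgy : 0 ≤ g y := by
      by_contra! h
      refine hy.2 (mem_interior_iff_mem_nhds.mpr ?_)
      filter_upwards [hg.continuous.continuousAt.eventually_lt_const h] with z hz using hz.le
    obtain ⟨T, hTc, hTo, hyT, hTs, hTpos⟩ := exists_convex_pos hg.differentiableAt (h0 y hyf) hgy
      (isOpen_interior.mem_nhds (hK hyK))
    refine (uniqueDiffWithinAt_convex hTc ?_ hyT).mono fun z hz =>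
      ⟨interior_subset (hTs hz), fun hzK => ?_⟩
    · rw [hTo.interior_eq]; exact closure_nonempty_iff.mp ⟨y, hyT⟩
    · have hzK' : z ∈ K := interior_subset hzK
      exact (hTpos z hz).not_ge hzK'
  · have h1 := (uniqueDiffWithinAt_convex hs hsne (subset_closure hy.1)).inter
      (hKc.isOpen_compl.mem_nhds hyK)
    exact h1.mono fun z hz => ⟨hz.1, fun h => hz.2 (interior_subset h)⟩

theorem ExtSetting.uniqueDiffOn_diff_interior {n : ℕ} (S : ExtSetting n) {s : Set (Euc n)}
    (hs : Convex ℝ s) (hK : S.K ⊆ interior s) : UniqueDiffOn ℝ (s \ interior S.K) := by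
  obtain ⟨g, hg, hKg, h0⟩ := S.hKsm
  have hne : (interior s).Nonempty := S.hKne.mono hK
  rw [hKg] at hK h0 ⊢
  exact uniqueDiffOn_diff_interior_sublevel (hg.differentiable (by simp)) h0 hs hK hne

theorem log_one_add_sq_le {s t δ : ℝ} (ht : 0 ≤ t) (hδ : 0 ≤ δ) (h : t ≤ s + δ) :
    Real.log (1 + t ^ 2) ≤ Real.log (1 + s ^ 2) + 2 * δ := by
  have hexp := Real.quadratic_le_exp_of_nonneg (show 0 ≤ 2 * δ by positivity)
  have h1 : 1 + t ^ 2 ≤ (1 + s ^ 2) * Real.exp (2 * δ) := by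
    have h2 : t ^ 2 ≤ (s + δ) ^ 2 := by gcongr
    have h3 : (1 + s ^ 2) * (1 + 2 * δ + (2 * δ) ^ 2 / 2) ≤ (1 + s ^ 2) * Real.exp (2 * δ) := by
      gcongr
    nlinarith [mul_nonneg hδ (sq_nonneg (s - 1)), mul_nonneg hδ (sq_nonneg s),
      sq_nonneg (s * δ), sq_nonneg δ]
  rw [← Real.log_exp (2 * δ), ← Real.log_mul (by positivity) (Real.exp_pos _).ne']
  exact Real.log_le_log (by positivity) h1

section Comparison

variable {n : ℕ} {U : Set (Euc n)} {u v : Euc n → ℝ}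

theorem dirD_sub_add_const_mul {w : Euc n → ℝ} (hu : ContDiffOn ℝ (⊤ : ℕ∞) u U)
    (hv : ContDiffOn ℝ (⊤ : ℕ∞) v U) (hw : ContDiffOn ℝ (⊤ : ℕ∞) w U) (hU : IsOpen U) (ε : ℝ)
    (η : Euc n) {x : Euc n} (hx : x ∈ U) :
    dirD η (fun y => v y - u y + ε * w y) x = dirD η v x - dirD η u x + ε * dirD η w x := by
  have h := (((hv.differentiableAt_of_isOpen hU hx).hasFDerivAt.sub
    (hu.differentiableAt_of_isOpen hU hx).hasFDerivAt).add
    ((hw.differentiableAt_of_isOpen hU hx).hasFDerivAt.const_mul ε))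
  have h2 : fderiv ℝ (fun y => v y - u y + ε * w y) x = _ := h.fderiv
  simp [dirD, h2]

theorem dirD_exp_inner (l c : ℝ) (e η : Euc n) :
    dirD η (fun y => c * Real.exp (l * ⟪e, y⟫)) = fun y => l * ⟪e, η⟫ * c * Real.exp (l * ⟪e, y⟫)
      := by
  funext x
  have h : HasFDerivAt (fun y : Euc n => l * ⟪e, y⟫) (l • innerSL ℝ e) x :=
    (innerSL ℝ e).hasFDerivAt.const_mul l
  have h2 := (h.exp.const_mul c).fderiv
  simp [dirD, h2]
  ring

/-- Comparison of a subsolution with a solution of the Gauss curvature equation. -/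
theorem subsolution_le_solution {f : Euc n → ℝ → ℝ} {D : Set (Euc n)} (hn : 0 < n)
    (hD : IsCompact D) (hU : IsOpen U) (hUD : U ⊆ D)
    (hu : ContDiffOn ℝ (⊤ : ℕ∞) u U) (hv : ContDiffOn ℝ (⊤ : ℕ∞) v U)
    (huc : ContinuousOn u D) (hvc : ContinuousOn v D) (hbd : ∀ x ∈ D \ U, v x ≤ u x)
    (huP : ∀ x ∈ U, (Hess u x).PosDef) (hvP : ∀ x ∈ U, (Hess v x).PosDef)
    (hfpos : ∀ x ∈ U, ∀ z, 0 < f x z) (hmono : ∀ x ∈ U, Monotone (f x))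
    (huK : ∀ x ∈ U, gaussK u x = f x (u x)) (hvK : ∀ x ∈ U, f x (v x) ≤ gaussK v x)
    {Λ : ℝ} (hΛ0 : 0 ≤ Λ) (hΛ : ∀ x ∈ U, ∀ e : Euc n, ‖e‖ = 1 → dirD e (dirD e u) x ≤ Λ) :
    ∀ x ∈ D, v x ≤ u x := by
  by_contra! hcon
  obtain ⟨y, hy, hlt⟩ := hcon
  set b : ℝ := ((n : ℝ) + 2) / 2 with hb
  have hnR : (0 : ℝ) < n := by exact_mod_cast hn
  set e : Euc n := EuclideanSpace.single ⟨0, hn⟩ 1 with he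
  have he1 : ‖e‖ = 1 := by simp [he]
  set l : ℝ := 2 * b * Λ + 1 with hl
  have hl0 : 0 < l := by positivity
  set φ : Euc n → ℝ := fun x => Real.exp (l * ⟪e, x⟫) with hφ
  have hφpos : ∀ x, 0 < φ x := fun x => Real.exp_pos _
  have hφc : ContDiff ℝ (⊤ : ℕ∞) φ :=
    Real.contDiff_exp.comp (contDiff_const.mul (contDiff_const.inner ℝ contDiff_id))
  obtain ⟨C, hC⟩ := hD.exists_bound_of_continuousOn hφc.continuous.continuousOn
  have hφC : ∀ x ∈ D, φ x ≤ C := fun x hx => (le_abs_self _).trans (hC x hx)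
  have hC0 : 0 < C := (hφpos y).trans_le (hφC y hy)
  set ε : ℝ := (v y - u y) / (2 * C) with hε
  have hε0 : 0 < ε := div_pos (by linarith) (by positivity)
  have hεC : ε * C = (v y - u y) / 2 := by rw [hε]; field_simp
  set h : Euc n → ℝ := fun x => v x - u x + ε * φ x with hh
  obtain ⟨x, hxD, hxmax⟩ := hD.exists_isMaxOn ⟨y, hy⟩ (f := h)
    ((hvc.sub huc).add (hφc.continuous.continuousOn.const_mul ε))
  have hhx : v y - u y + ε * φ y ≤ v x - u x + ε * φ x := hxmax hy
  have hφx : ε * φ x ≤ ε * C := mul_le_mul_of_nonneg_left (hφC x hxD) hε0.le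
  have hφy := mul_pos hε0 (hφpos y)
  have hxU : x ∈ U := by
    by_contra hx
    have := hbd x ⟨hxD, hx⟩
    linarith
  have huv : u x ≤ v x := by linarith
  have hloc : IsLocalMax h x := by
    filter_upwards [hU.mem_nhds hxU] with z hz using hxmax (hUD hz)
  have hφU : ContDiffOn ℝ (⊤ : ℕ∞) φ U := hφc.contDiffOn
  have hhU : ContDiffOn ℝ (⊤ : ℕ∞) h U := (hv.sub hu).add (contDiffOn_const.mul hφU)
  have hφ1 : ∀ η : Euc n, dirD η φ = fun y => l * ⟪e, η⟫ * φ y := fun η => by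
    simpa using dirD_exp_inner l 1 e η
  have hφ2 : ∀ η : Euc n, dirD η (dirD η φ) x = l ^ 2 * ⟪e, η⟫ ^ 2 * φ x := fun η => by
    rw [hφ1, dirD_exp_inner]; ring
  have hfirst : ∀ η, dirD η v x - dirD η u x + ε * (l * ⟪e, η⟫ * φ x) = 0 := fun η => by
    have := hloc.dirD_eq_zero η
    rwa [dirD_sub_add_const_mul hu hv hφU hU ε η hxU, hφ1] at this
  have hsecond : ∀ η, dirD η (dirD η v) x ≤
      dirD η (dirD η u) x - ε * (l ^ 2 * ⟪e, η⟫ ^ 2 * φ x) := fun η => by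
    have := hloc.dirD_dirD_nonpos hhU hU hxU η
    rw [dirD_congr (fun z hz => dirD_sub_add_const_mul hu hv hφU hU ε η hz) hU η hxU,
      dirD_sub_add_const_mul (hu.dirD hU η) (hv.dirD hU η) (hφU.dirD hU η) hU ε η hxU, hφ2] at this
    linarith
  set δ : ℝ := ε * l * φ x with hδ
  have hδ0 : 0 < δ := mul_pos (mul_pos hε0 hl0) (hφpos x)
  have hgrad : ‖fderiv ℝ u x‖ ≤ ‖fderiv ℝ v x‖ + δ := by
    have h1 : fderiv ℝ u x = fderiv ℝ v x + δ • innerSL ℝ e := by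
      ext η
      have := hfirst η
      simp only [dirD] at this
      simp only [add_apply, smul_apply, smul_eq_mul, innerSL_apply_apply]
      rw [hδ]; linarith
    rw [h1]
    refine (norm_add_le _ _).trans (le_of_eq ?_)
    rw [norm_smul, innerSL_apply_norm, he1, mul_one, Real.norm_of_nonneg hδ0.le]
  obtain ⟨η, d, hd, hdet1, htr, hamgm, hdual⟩ := exists_hessian_frame hn hu hU hxU (huP x hxU)
  set Q := ∑ k, ⟪e, η k⟫ ^ 2 with hQ
  have hQ1 : 1 ≤ Λ * Q := by
    have h1 := hdual e
    rw [he1, one_pow] at h1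
    exact h1.trans (mul_le_mul_of_nonneg_right (hΛ x hxU e he1)
      (Finset.sum_nonneg fun k _ => sq_nonneg _))
  have hamv := hamgm v U hv hU x hxU (hvP x hxU)
  set σ := ∑ k, dirD (η k) (dirD (η k) v) x with hσ
  have hσle : σ ≤ n - δ * l * Q := by
    have h1 := Finset.sum_le_sum fun k (_ : k ∈ Finset.univ) => hsecond (η k)
    rw [Finset.sum_sub_distrib, htr] at h1
    refine h1.trans (le_of_eq ?_)
    rw [hδ, hQ, Finset.mul_sum]
    congr 1
    exact Finset.sum_congr rfl fun k _ => by ring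
  have hdu := (huP x hxU).det_pos
  have hdv := (hvP x hxU).det_pos
  have hσ0 : 0 < σ := by
    refine lt_of_le_of_ne (Finset.sum_nonneg fun k _ =>
      dirD_dirD_nonneg_of_posDef hv hU hxU (hvP x hxU) (η k)) fun h0 => ?_
    rw [← h0, zero_div, zero_pow hn.ne'] at hamv
    exact (mul_pos hdv hd).not_ge hamv
  have hlog := Real.log_le_log (mul_pos hdv hd) hamv
  rw [Real.log_mul hdv.ne' hd.ne', Real.log_pow] at hlog
  have hlog2 : (n : ℝ) * Real.log (σ / n) ≤ σ - n := by
    have := mul_le_mul_of_nonneg_left (Real.log_le_sub_one_of_pos (div_pos hσ0 hnR)) hnR.le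
    rwa [mul_sub, mul_one, mul_div_cancel₀ _ hnR.ne'] at this
  have hlogd : Real.log (Hess u x).det + Real.log d = 0 := by
    rw [← Real.log_mul hdu.ne' hd.ne', hdet1, Real.log_one]
  have hfv := hvK x hxU
  have hlu := log_det_eq (huK x hxU) (hfpos x hxU _)
  have hlv := log_det_eq (f := fun z _ => gaussK v z) (u := v) (x := x) rfl
    ((hfpos x hxU _).trans_le hfv)
  have hlf : Real.log (f x (u x)) ≤ Real.log (gaussK v x) :=
    Real.log_le_log (hfpos x hxU _) ((hmono x hxU huv).trans hfv)
  have hlg := mul_le_mul_of_nonneg_left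
    (log_one_add_sq_le (norm_nonneg _) hδ0.le hgrad) (show 0 ≤ b by positivity)
  rw [← hb] at hlu hlv
  have hfin : δ * (l * Q) ≤ δ * (2 * b) := by linarith
  have hfin2 := le_of_mul_le_mul_left hfin hδ0
  have := mul_le_mul_of_nonneg_left hfin2 hΛ0
  have := mul_le_mul_of_nonneg_left hQ1 hl0.le
  linarith

end Comparison

/-- The gradient of a convex function which lies above `v` and agrees with `v` on the boundary is
bounded by the gradient of `v`. -/
theorem norm_fderiv_le_of_barrier {n : ℕ} {U D : Set (Euc n)} {u v : Euc n → ℝ} {C₀ : ℝ}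
    (hD : IsCompact D) (hU : IsOpen U) (hUD : U ⊆ D)
    (hu : ContDiffOn ℝ (⊤ : ℕ∞) u U) (hv : ContDiffOn ℝ (⊤ : ℕ∞) v U)
    (huc : ContinuousOn u D) (hvc : ContinuousOn v D) (hle : ∀ x ∈ D, v x ≤ u x)
    (hbd : ∀ x ∈ D \ U, u x = v x) (huP : ∀ x ∈ U, (Hess u x).PosDef)
    (hC₀ : ∀ x ∈ U, ‖fderiv ℝ v x‖ ≤ C₀) {x : Euc n} (hx : x ∈ U) : ‖fderiv ℝ u x‖ ≤ C₀ := by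
  by_contra! hlt
  have hC0 : 0 ≤ C₀ := (norm_nonneg _).trans (hC₀ x hx)
  obtain ⟨e, he1, hpe⟩ : ∃ e : Euc n, ‖e‖ ≤ 1 ∧ C₀ < dirD e u x := by
    obtain ⟨w, hw0, hw⟩ := (fderiv ℝ u x).exists_lt_apply_of_lt_opNorm hlt
    rw [Real.norm_eq_abs] at hw
    rcases abs_cases (fderiv ℝ u x w) with h | h
    · exact ⟨w, hw0.le, by rw [dirD]; linarith⟩
    · exact ⟨-w, by rw [norm_neg]; exact hw0.le, by rw [dirD, map_neg]; linarith⟩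
  have he0 : 0 < ‖e‖ := by
    rw [norm_pos_iff]
    rintro rfl
    rw [dirD, map_zero] at hpe
    linarith
  have hcont : Continuous fun t : ℝ => x + t • e := by fun_prop
  set A : Set ℝ := {t | 0 ≤ t ∧ x + t • e ∉ U} with hA
  have hAc : IsClosed A :=
    isClosed_Ici.inter (hU.isClosed_compl.preimage hcont)
  have hAne : A.Nonempty := by
    obtain ⟨r, hr⟩ := hD.isBounded.subset_ball 0
    have hxr : ‖x‖ < r := by simpa using hr (hUD hx)
    have hr0 : 0 < r := (norm_nonneg x).trans_lt hxr
    refine ⟨(r + ‖x‖) / ‖e‖, by positivity, fun hmem => ?_⟩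
    have h1 : ‖x + ((r + ‖x‖) / ‖e‖) • e‖ < r := by simpa using hr (hUD hmem)
    have h2 : ‖((r + ‖x‖) / ‖e‖) • e‖ = r + ‖x‖ := by
      rw [norm_smul, Real.norm_of_nonneg (by positivity), div_mul_cancel₀ _ he0.ne']
    have h3 := norm_sub_le (x + ((r + ‖x‖) / ‖e‖) • e) x
    rw [add_sub_cancel_left, h2] at h3
    linarith
  have hAb : BddBelow A := ⟨0, fun t ht => ht.1⟩
  set T := sInf A with hT
  have hTA : T ∈ A := hAc.csInf_mem hAne hAb
  have hT0 : 0 < T := by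
    refine lt_of_le_of_ne hTA.1 fun h0 => hTA.2 ?_
    rw [← h0]; simpa using hx
  have hin : ∀ t ∈ Ico 0 T, x + t • e ∈ U := fun t ht => by
    by_contra h
    exact (csInf_le hAb ⟨ht.1, h⟩).not_gt ht.2
  have hTD : x + T • e ∈ D := by
    refine hD.isClosed.mem_of_tendsto
      (hcont.continuousAt.tendsto.mono_left (nhdsWithin_le_nhds (s := Iio T))) ?_
    filter_upwards [Ioo_mem_nhdsLT hT0] with t ht using hUD (hin t ⟨ht.1.le, ht.2⟩)
  have hmaps : MapsTo (fun t : ℝ => x + t • e) (Icc 0 T) D := fun t ht => by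
    rcases ht.2.lt_or_eq with h | h
    · exact hUD (hin t ⟨ht.1, h⟩)
    · rw [h]; exact hTD
  have hderu : ∀ t ∈ Ico 0 T, HasDerivAt (fun s : ℝ => u (x + s • e)) (dirD e u (x + t • e)) t :=
    fun t ht => hasDerivAt_line hu hU x e (hin t ht)
  have hderv : ∀ t ∈ Ico 0 T, HasDerivAt (fun s : ℝ => v (x + s • e)) (dirD e v (x + t • e)) t :=
    fun t ht => hasDerivAt_line hv hU x e (hin t ht)
  have hderu2 : ∀ t ∈ Ico 0 T, HasDerivAt (fun s : ℝ => dirD e u (x + s • e))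
      (dirD e (dirD e u) (x + t • e)) t :=
    fun t ht => hasDerivAt_line (hu.dirD hU e) hU x e (hin t ht)
  have hmono : MonotoneOn (fun s : ℝ => dirD e u (x + s • e)) (Ico 0 T) := by
    refine monotoneOn_of_deriv_nonneg (convex_Ico 0 T)
      (fun t ht => (hderu2 t ht).continuousAt.continuousWithinAt)
      (fun t ht => (hderu2 t (interior_subset ht)).differentiableAt.differentiableWithinAt)
      fun t ht => ?_
    have ht := interior_subset ht
    rw [(hderu2 t ht).deriv]
    exact dirD_dirD_nonneg_of_posDef hu hU (hin t ht) (huP _ (hin t ht)) e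
  have hstrict : StrictMonoOn (fun s : ℝ => u (x + s • e) - v (x + s • e)) (Icc 0 T) := by
    refine strictMonoOn_of_deriv_pos (convex_Icc 0 T)
      ((huc.comp hcont.continuousOn hmaps).sub (hvc.comp hcont.continuousOn hmaps)) fun t ht => ?_
    rw [interior_Icc] at ht
    have ht : t ∈ Ico 0 T := Ioo_subset_Ico_self ht
    have h1 := ((hderu t ht).sub (hderv t ht)).deriv
    have h2 : dirD e u x ≤ dirD e u (x + t • e) := by
      simpa using hmono (left_mem_Ico.mpr hT0) ht ht.1
    have h3 : dirD e v (x + t • e) ≤ C₀ := by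
      have h4 := (fderiv ℝ v (x + t • e)).le_opNorm e
      have h5 : ‖fderiv ℝ v (x + t • e)‖ * ‖e‖ ≤ C₀ * 1 :=
        mul_le_mul (hC₀ _ (hin t ht)) he1 (norm_nonneg _) hC0
      rw [mul_one] at h5
      exact (le_abs_self _).trans (h4.trans h5)
    change 0 < deriv ((fun s : ℝ => u (x + s • e)) - fun s : ℝ => v (x + s • e)) t
    rw [h1]
    linarith
  have h1 := hstrict (left_mem_Icc.mpr hT0.le) (right_mem_Icc.mpr hT0.le) hT0
  have h2 := hle x (hUD hx)
  have h3 := hbd _ ⟨hTD, hTA.2⟩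
  simp only [zero_smul, add_zero] at h1
  linarith

namespace ExtSetting

variable {n : ℕ} (S : ExtSetting n)

theorem uniqueDiffOn_compl_interior : UniqueDiffOn ℝ (interior S.K)ᶜ := by
  rw [compl_eq_univ_sdiff]
  exact S.uniqueDiffOn_diff_interior convex_univ (by simp)

theorem compl_interior_mem_nhds {x : Euc n} (hx : x ∈ S.Kᶜ) : (interior S.K)ᶜ ∈ 𝓝 x :=
  mem_of_superset (S.hKc.isClosed.isOpen_compl.mem_nhds hx) (compl_subset_compl.mpr interior_subset)

theorem exists_norm_fderiv_ul_le : ∃ C₀ : ℝ, ∀ x ∈ S.Kᶜ, ‖fderiv ℝ S.ul x‖ ≤ C₀ := by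
  obtain ⟨C, R₁, hC⟩ := S.huldec1
  set R := max R₁ S.R₀ with hR
  have hR0 : 0 < R := S.hR₀.trans_le (le_max_right _ _)
  obtain ⟨B, hB⟩ := ((isCompact_closedBall (0 : Euc n) R).diff
    isOpen_interior).exists_bound_of_continuousOn (f := fderivWithin ℝ S.ul (interior S.K)ᶜ)
    ((S.hulsm.continuousOn_fderivWithin S.uniqueDiffOn_compl_interior (by simp)).mono
      fun x hx => hx.2)
  refine ⟨max B (|C| / R + 1), fun x hx => ?_⟩
  rcases le_total ‖x‖ R with h | h
  · refine le_max_of_le_left ?_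
    rw [← fderivWithin_of_mem_nhds (S.compl_interior_mem_nhds hx)]
    exact hB x ⟨by simpa using h, fun hi => hx (interior_subset hi)⟩
  · refine le_max_of_le_right ?_
    have hx0 : x ≠ 0 := by
      rintro rfl
      exact hx (interior_subset S.hK0)
    have hd1 : DifferentiableAt ℝ S.ul x :=
      (S.hulsm.contDiffAt (S.compl_interior_mem_nhds hx)).differentiableAt (by simp)
    have hd2 : DifferentiableAt ℝ (fun y : Euc n => ‖y‖) x := differentiableAt_id.norm ℝ hx0
    have h1 := hC x ((le_max_left _ _).trans h)
    rw [fderiv_fun_sub hd1 hd2] at h1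
    have h2 : ‖fderiv ℝ (fun y : Euc n => ‖y‖) x‖ ≤ 1 := by
      simpa using norm_fderiv_le_of_lipschitz ℝ (lipschitzWith_one_norm (E := Euc n)) (x₀ := x)
    have h3 : C / ‖x‖ ≤ |C| / R := by
      gcongr
      exact le_abs_self C
    have h4 := norm_add_le (fderiv ℝ S.ul x - fderiv ℝ (fun y : Euc n => ‖y‖) x)
      (fderiv ℝ (fun y : Euc n => ‖y‖) x)
    rw [sub_add_cancel] at h4
    linarith

theorem isOpen_ball_diff (R : ℝ) : IsOpen (ball 0 R \ S.K) := isOpen_ball.sdiff S.hKc.isClosed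

theorem ball_diff_subset_solDom (R : ℝ) : ball 0 R \ S.K ⊆ solDom S R := fun _ hx =>
  ⟨ball_subset_closedBall hx.1, fun h => hx.2 (interior_subset h)⟩

theorem isCompact_solDom (R : ℝ) : IsCompact (solDom S R) :=
  (isCompact_closedBall 0 R).diff isOpen_interior

theorem solDom_diff_subset (R : ℝ) :
    solDom S R \ (ball 0 R \ S.K) ⊆ sphere 0 R ∪ frontier S.K := by
  rintro x ⟨⟨hx, hxi⟩, hxU⟩
  by_cases hxK : x ∈ S.K
  · exact Or.inr ⟨subset_closure hxK, hxi⟩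
  · exact Or.inl ((mem_closedBall.mp hx).lt_or_eq.resolve_left fun h => hxU ⟨h, hxK⟩)

theorem boundary_subset_solDom {R : ℝ} (hR : S.R₀ < R) :
    sphere 0 R ∪ frontier S.K ⊆ solDom S R := by
  rintro x (hx | hx)
  · refine ⟨sphere_subset_closedBall hx, fun h => ?_⟩
    have h1 := S.hKR₀ (interior_subset h)
    rw [mem_sphere] at hx
    rw [mem_ball, hx] at h1
    linarith
  · exact ⟨closedBall_subset_closedBall hR.le
      (ball_subset_closedBall (S.hKR₀ (S.hKc.isClosed.frontier_subset hx))), hx.2⟩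

theorem uniqueDiffOn_solDom {R : ℝ} (hR : S.R₀ < R) : UniqueDiffOn ℝ (solDom S R) :=
  S.uniqueDiffOn_diff_interior (convex_closedBall 0 R)
    ((S.hKR₀.trans (ball_subset_ball hR.le)).trans ball_subset_interior_closedBall)

end ExtSetting

theorem iteratedFDerivWithin_of_mem_nhds {E F : Type*} [NormedAddCommGroup E] [NormedSpace ℝ E]
    [NormedAddCommGroup F] [NormedSpace ℝ F] {g : E → F} {s : Set E} {x : E} (hs : s ∈ 𝓝 x)
    (m : ℕ) : iteratedFDerivWithin ℝ m g s x = iteratedFDeriv ℝ m g x := by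
  rw [← iteratedFDerivWithin_univ]
  exact iteratedFDerivWithin_congr_set (eventuallyEq_univ.mpr hs) m

theorem interior_C2_reduction_to_boundary
    (n : ℕ) (S : ExtSetting n) :
    ∃ c : ℝ, ∀ R : ℝ, 4 * S.R₀ < R → ∀ u : Euc n → ℝ, IsSol S R u →
      ∀ x ∈ solDom S R,
        ‖iteratedFDerivWithin ℝ 2 u (solDom S R) x‖
          ≤ c + sSup ((fun y => ‖iteratedFDerivWithin ℝ 2 u (solDom S R) y‖) ''
              (sphere (0 : Euc n) R ∪ frontier S.K)) := by
  obtain ⟨C₀, hC₀⟩ := S.exists_norm_fderiv_ul_le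
  obtain ⟨C, hC⟩ := S.hfder
  set C₁ := max C 0 with hC₁
  have hn : 0 < n := by have := S.hn; omega
  have hC₁0 : 0 ≤ C₁ := le_max_right _ _
  refine ⟨max 0 (1 + (1 + C₀ ^ 2) *
      (C₁ * (1 + C₀) ^ 2 + (C₁ * (1 + C₀)) ^ 2 + 4 * (C₁ * (1 + C₀)))), fun R hR u hsol x hx => ?_⟩
  obtain ⟨hus, huP, huK, hub⟩ := hsol
  have hR₀ : S.R₀ < R := by linarith [S.hR₀]
  set D := solDom S R with hD
  set U := ball (0 : Euc n) R \ S.K with hUdef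
  have hU : IsOpen U := S.isOpen_ball_diff R
  have hUD : U ⊆ D := S.ball_diff_subset_solDom R
  have hDc : IsCompact D := S.isCompact_solDom R
  have hUK : U ⊆ S.Kᶜ := fun y hy => hy.2
  have hUi : U ⊆ (interior S.K)ᶜ := fun y hy => (hUD hy).2
  have hbdD := S.boundary_subset_solDom hR₀
  have hDU : ∀ y ∈ U, D ∈ 𝓝 y := fun y hy => mem_of_superset (hU.mem_nhds hy) hUD
  have hit : ∀ y ∈ U, iteratedFDerivWithin ℝ 2 u D y = iteratedFDeriv ℝ 2 u y := fun y hy =>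
    iteratedFDerivWithin_of_mem_nhds (hDU y hy) 2
  have huU := hus.mono hUD
  have hulU : ContDiffOn ℝ (⊤ : ℕ∞) S.ul U := S.hulsm.mono hUi
  have hulc : ContinuousOn S.ul D := S.hulsm.continuousOn.mono fun y hy => hy.2
  have hfU := S.hfsm.mono (prod_mono_left (t := (univ : Set ℝ)) hUi)
  obtain ⟨x₀, hx₀, hmax⟩ := hDc.exists_isMaxOn ⟨x, hx⟩
    (f := fun y => ‖iteratedFDerivWithin ℝ 2 u D y‖)
    (hus.continuousOn_iteratedFDerivWithin two_le_smooth (S.uniqueDiffOn_solDom hR₀)).norm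
  set N : Euc n → ℝ := fun y => ‖iteratedFDerivWithin ℝ 2 u D y‖ with hN
  have hmax : ∀ y ∈ D, N y ≤ N x₀ := fun y hy => hmax hy
  have hsup : 0 ≤ sSup (N '' (sphere (0 : Euc n) R ∪ frontier S.K)) := by
    refine Real.sSup_nonneg ?_
    rintro _ ⟨y, -, rfl⟩
    exact norm_nonneg _
  refine (hmax x hx).trans ?_
  by_cases hx₀U : x₀ ∈ U
  · have hcmp : ∀ y ∈ D, S.ul y ≤ u y := by
      refine subsolution_le_solution (f := S.f) (Λ := N x₀) hn hDc hU hUD huU hulU hus.continuousOn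
        hulc (fun y hy => (hub y (S.solDom_diff_subset R hy)).ge) huP
        (fun y hy => S.hulconv y (hUK hy)) (fun y hy => S.hfpos y (hUi hy))
        (fun y hy => S.hfz y (hUi hy)) huK (fun y hy => S.hulsub y (hUK hy)) (norm_nonneg _)
        fun y hy e he => ?_
      have h1 := (iteratedFDeriv ℝ 2 u y).le_opNorm ![e, e]
      rw [iteratedFDeriv_two_eq_dirD huU hU _ hy, ← hit y hy] at h1
      simp only [Matrix.cons_val_zero, Matrix.cons_val_one, Fin.prod_univ_two, he, mul_one] at h1
      exact (le_abs_self _).trans (h1.trans (hmax y (hUD hy)))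
    have hgrad : ‖fderiv ℝ u x₀‖ ≤ C₀ :=
      norm_fderiv_le_of_barrier hDc hU hUD huU hulU hus.continuousOn hulc hcmp
        (fun y hy => hub y (S.solDom_diff_subset R hy)) huP (fun y hy => hC₀ y (hUK hy)) hx₀U
    have hnhds : (interior S.K)ᶜ ×ˢ (univ : Set ℝ) ∈ 𝓝 (x₀, u x₀) :=
      prod_mem_nhds (S.compl_interior_mem_nhds (hUK hx₀U)) univ_mem
    have hder := hC (x₀, u x₀) ⟨hUi hx₀U, mem_univ _⟩
    rw [fderivWithin_of_mem_nhds hnhds, iteratedFDerivWithin_of_mem_nhds hnhds] at hder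
    have hfx := S.hfpos x₀ (hUi hx₀U) (u x₀)
    have hfin := hessian_norm_le_of_interior_max S.hn hU huU huP hfU
      (fun y hy => S.hfpos y (hUi hy)) huK hx₀U (S.hfz x₀ (hUi hx₀U)) hC₁0 hgrad
      (hder.trans (mul_le_mul_of_nonneg_right (le_max_left _ _) hfx.le))
      fun y hy => by simpa only [hN, hit y hy, hit x₀ hx₀U] using hmax y (hUD hy)
    rw [← hit x₀ hx₀U] at hfin
    exact (hfin.trans (le_max_right _ _)).trans (le_add_of_nonneg_right hsup)
  · have hle : N x₀ ≤ sSup (N '' (sphere (0 : Euc n) R ∪ frontier S.K)) := by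
      refine le_csSup ⟨N x₀, ?_⟩ ⟨x₀, S.solDom_diff_subset R ⟨hx₀, hx₀U⟩, rfl⟩
      rintro _ ⟨y, hy, rfl⟩
      exact hmax y (hbdD hy)
    exact hle.trans (le_add_of_nonneg_left (le_max_left _ _))
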